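/- Let X be an infinite ℤ²-subshift with finitely many nonexpansive rays, all of which are rational and closing. Then: (1) if E ⊆ ℝ² is a one-dimensional rational subspace both of whose rays are expansive for X, then there exist nonexpansive rays ρ₁, ρ₂ of X and nonzero vectors u₁ ∈ ρ₁, u₂ ∈ ρ₂ lying in different connected components of ℝ² \ E; in particular X has at least 2 distinct nonexpansive rays; (2) if X has exactly two nonexpansive rays, they are antiparallel; (3) if the nonexpansive rays of X are ℓ₁, …, ℓₙ with n ≥ 3, then there exist nonzero vectors eᵢ ∈ ℓᵢ ∩ ℤ² with e₁ + ⋯ + eₙ = 0 such that, when listed in cyclic order of the angle they make with the positive x-axis and concatenated end to end, the eᵢ form the oriented edges of a convex polygon. -/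

import Mathlib

namespace PolygonalShifts

abbrev Z2 : Type := ℤ × ℤ

abbrev Config (A : Type*) : Type _ := Z2 → A

/-- The translation action of `ℤ²` on configurations. -/
def shiftAct {A : Type*} (u : Z2) (x : Config A) : Config A := fun w => x (u + w)

/-- A `ℤ²`-subshift: a closed (for the product topology, with the alphabet discrete)
and translation-invariant set of configurations. -/
def IsSubshift {A : Type*} (X : Set (Config A)) : Prop :=
  (letI : TopologicalSpace A := ⊥
   IsClosed X) ∧
  ∀ u : Z2, ∀ x ∈ X, shiftAct u x ∈ X

/-- The canonical embedding `ℤ² → ℝ²`. -/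
def toR2 (p : Z2) : ℝ × ℝ := ((p.1 : ℝ), (p.2 : ℝ))

/-- `S` X-codes `S'`, for subsets `S, S'` of `ℝ²`. -/
def Codes {A : Type*} (X : Set (Config A)) (S S' : Set (ℝ × ℝ)) : Prop :=
  ∀ x ∈ X, ∀ x' ∈ X,
    (∀ p : Z2, toR2 p ∈ S → x p = x' p) →
    ∀ p : Z2, toR2 p ∈ S' → x p = x' p

/-- `S` X-codes `S'`, for subsets `S, S'` of `ℤ²`. -/
def CodesZ {A : Type*} (X : Set (Config A)) (S S' : Set Z2) : Prop :=
  ∀ x ∈ X, ∀ x' ∈ X, (∀ p ∈ S, x p = x' p) → ∀ p ∈ S', x p = x' p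

/-- `Y` is a recoding of `X` via the finite set `F ⊆ ℤ²`. -/
def IsRecodingVia {A A' : Type*} (X : Set (Config A)) (Y : Set (Config A'))
    (F : Set Z2) : Prop :=
  letI : TopologicalSpace A := ⊥
  letI : TopologicalSpace A' := ⊥
  ∃ Ψ : X ≃ₜ Y,
    (∀ (u : Z2) (x x' : X), (x' : Config A) = shiftAct u (x : Config A) →
      (↑(Ψ x') : Config A') = shiftAct u (↑(Ψ x) : Config A')) ∧
    (∀ (u : Z2) (x x' : X),
      (↑(Ψ x) : Config A') u = (↑(Ψ x') : Config A') u ↔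
        ∀ f ∈ F, (x : Config A) (f + u) = (x' : Config A) (f + u))

/-- `Y` is a recoding of `X`. -/
def IsRecoding {A A' : Type*} (X : Set (Config A)) (Y : Set (Config A')) : Prop :=
  ∃ F : Set Z2, F.Finite ∧ IsRecodingVia X Y F

/-- Integer cross product. -/
def crossZ (u v : Z2) : ℤ := u.1 * v.2 - u.2 * v.1

/-- Real cross product. -/
def crossR (u v : ℝ × ℝ) : ℝ := u.1 * v.2 - u.2 * v.1

/-- A convex integer polygon, given by its (at least three) vertices listed in
counterclockwise order: every vertex lies strictly to the left of every directed edge. -/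
structure IntPolygon where
  n : ℕ
  vert : Fin (n + 3) → Z2
  convex : ∀ i j : Fin (n + 3), j ≠ i → j ≠ i + 1 →
    0 < crossZ (vert (i + 1) - vert i) (vert j - vert i)

namespace IntPolygon

/-- The oriented edge vector from vertex `i` to vertex `i+1`. -/
def edgeVec (P : IntPolygon) (i : Fin (P.n + 3)) : Z2 := P.vert (i + 1) - P.vert i

/-- The polygon as a subset of `ℝ²` (the convex hull of its vertices). -/
def carrier (P : IntPolygon) : Set (ℝ × ℝ) :=
  convexHull ℝ (Set.range fun i => toR2 (P.vert i))

lemma crossZ_smul (m : ℤ) (u v : Z2) : crossZ (m • u) (m • v) = m ^ 2 * crossZ u v := by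
  simp only [crossZ, Prod.smul_fst, Prod.smul_snd, smul_eq_mul]
  ring

/-- The dilation of a polygon by a positive integer factor about the origin. -/
def dilate (P : IntPolygon) (m : ℤ) (hm : 0 < m) : IntPolygon where
  n := P.n
  vert := fun i => m • P.vert i
  convex := by
    intro i j hj hj1
    have h := P.convex i j hj hj1
    have e1 : m • P.vert (i + 1) - m • P.vert i = m • (P.vert (i + 1) - P.vert i) :=
      (smul_sub m _ _).symm
    have e2 : m • P.vert j - m • P.vert i = m • (P.vert j - P.vert i) :=
      (smul_sub m _ _).symm
    rw [e1, e2, crossZ_smul]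
    exact mul_pos (pow_pos hm 2) h

end IntPolygon

/-- `P` is a coding polygon for `X`: for each vertex `w`, the polygon with `w`
removed X-codes `w`. -/
def IsCodingPolygon {A : Type*} (X : Set (Config A)) (P : IntPolygon) : Prop :=
  ∀ i : Fin (P.n + 3),
    Codes X (P.carrier \ {toR2 (P.vert i)}) {toR2 (P.vert i)}

/-- `X` is polygonal with respect to `P`. -/
def Polygonal {A : Type*} (X : Set (Config A)) (P : IntPolygon) : Prop :=
  X.Infinite ∧ IsCodingPolygon X P

/-- The closed half plane `H_v = {w : v₁ w₂ − v₂ w₁ ≥ 0}` to the left of the direction `v`. -/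
def leftHalfPlane (v : ℝ × ℝ) : Set (ℝ × ℝ) := {w | 0 ≤ v.1 * w.2 - v.2 * w.1}

/-- The ray directed by `v` is expansive for `X`: `H_v` X-codes all of `ℝ²`. -/
def ExpansiveRay {A : Type*} (X : Set (Config A)) (v : ℝ × ℝ) : Prop :=
  Codes X (leftHalfPlane v) Set.univ

/-- For a primitive integer direction `v`, the line `L₀`: the translate of `L = ℝ·v`
by an integer vector, lying outside `H_v` and closest to `L`. -/
def lineL0 (v : Z2) : Set (ℝ × ℝ) := {w | (v.1 : ℝ) * w.2 - (v.2 : ℝ) * w.1 = -1}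

/-- A block of `m` consecutive lattice points on `L₀`, starting at `z`. -/
def blockOn (v z : Z2) (m : ℕ) : Set (ℝ × ℝ) :=
  (fun k : ℕ => toR2 (z + (k : ℤ) • v)) '' {k | k < m}

/-- The (nonexpansive) rational ray directed by the primitive vector `v` is closing for `X`. -/
def ClosingRay {A : Type*} (X : Set (Config A)) (v : Z2) : Prop :=
  ∃ N : ℕ, ∀ z : Z2, v.1 * z.2 - v.2 * z.1 = -1 →
    ∀ m : ℕ, N ≤ m →
      Codes X (leftHalfPlane (toR2 v) ∪ blockOn v z m) (lineL0 v)

/-- The sector (with vertex the origin) determined by the rays through `e₁` and `e₂`: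
lattice points on either ray or strictly between them. -/
def SectorZ (e₁ e₂ : Z2) : Set Z2 :=
  {p | SameRay ℝ (toR2 e₁) (toR2 p) ∨ SameRay ℝ (toR2 e₂) (toR2 p) ∨
       (0 < crossZ e₁ p ∧ 0 < crossZ p e₂)}

/-- The rational sector determined by `(e₁, e₂)` is corner coding for `X`. -/
def IsCornerCoding {A : Type*} (X : Set (Config A)) (e₁ e₂ : Z2) : Prop :=
  CodesZ X (SectorZ e₁ e₂ \ {0}) {0}

/-- The rational sector determined by `(e₁, e₂)` is weakly corner coding for `X`. -/
def IsWeaklyCornerCoding {A : Type*} (X : Set (Config A)) (e₁ e₂ : Z2) : Prop :=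
  ∃ F₀ : Set Z2, F₀.Finite ∧ F₀ ⊆ SectorZ e₁ e₂ ∧
    ∀ F : Set Z2, F.Finite → F ⊆ SectorZ e₁ e₂ →
      CodesZ X (SectorZ e₁ e₂ \ F) (SectorZ e₁ e₂ \ F₀)

/-- The sector based at the vertex `i` of the polygon `P`: lattice points in the convex
cone with apex `P.vert i` spanned by the two edges of `P` incident to that vertex. -/
def vertexSector (P : IntPolygon) (i : Fin (P.n + 3)) : Set Z2 :=
  {p | ∃ s t : ℝ, 0 ≤ s ∧ 0 ≤ t ∧
    toR2 p = toR2 (P.vert i) + s • toR2 (P.vert (i - 1) - P.vert i)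
      + t • toR2 (P.vert (i + 1) - P.vert i)}

/-- `P` is a coding polygon for some recoding of `X`. -/
def HasRecodingPolygon {A : Type*} (X : Set (Config A)) (P : IntPolygon) : Prop :=
  ∃ (A' : Type) (_ : Fintype A') (Y : Set (Config A')),
    IsSubshift Y ∧ IsRecoding X Y ∧ IsCodingPolygon Y P

/-- `P` is a minimal recoding polygon for `X`. -/
def IsMinimalRecodingPolygon {A : Type*} (X : Set (Config A)) (P : IntPolygon) : Prop :=
  HasRecodingPolygon X P ∧
  (∀ Q : IntPolygon, HasRecodingPolygon X Q → P.n ≤ Q.n) ∧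
  (∀ Q : IntPolygon, HasRecodingPolygon X Q → Q.n = P.n →
    Q.carrier ⊆ P.carrier → Q.carrier = P.carrier)


/-- `D` is the (finite) set of directions of the nonexpansive rays of `X`: a finite set
of primitive integer vectors, each directing a nonexpansive ray, such that every
nonexpansive ray of `X` has its direction in `D`. -/
def NonexpansiveDirSet {A : Type*} (X : Set (Config A)) (D : Finset Z2) : Prop :=
  (∀ v ∈ D, Int.gcd v.1 v.2 = 1) ∧
  (∀ v ∈ D, ¬ ExpansiveRay X (toR2 v)) ∧
  (∀ u : ℝ × ℝ, u ≠ 0 → ¬ ExpansiveRay X u → ∃ v ∈ D, SameRay ℝ (toR2 v) u)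


section Strip

/-- A translation-invariant family of planar sets which contain, near each of their points, a
point strictly above or one to the left on the same row, a point strictly below or one to the left
on the same row, and points on the left of every non-horizontal line: such a set, if it meets a
thick horizontal strip, continues to the left in this strip with bounded gaps. -/
lemma exists_strip {𝒟 : Set (Set Z2)}
    (htrans : ∀ S ∈ 𝒟, ∀ u : Z2, {q | u + q ∈ S} ∈ 𝒟)
    (hup : ∃ N R : ℕ, ∀ S ∈ 𝒟, (0 : Z2) ∈ S →
      (∃ q ∈ S, 0 < q.2 ∧ |q.1| ≤ R ∧ |q.2| ≤ R) ∨ ∃ k : ℤ, 1 ≤ k ∧ k ≤ N ∧ ((-k, 0) : Z2) ∈ S)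
    (hdown : ∃ N R : ℕ, ∀ S ∈ 𝒟, (0 : Z2) ∈ S →
      (∃ q ∈ S, q.2 < 0 ∧ |q.1| ≤ R ∧ |q.2| ≤ R) ∨ ∃ k : ℤ, 1 ≤ k ∧ k ≤ N ∧ ((-k, 0) : Z2) ∈ S)
    (hleft : ∀ β : ℝ, ∃ ε > 0, ∃ R : ℕ, ∀ b : ℝ, |b| ≤ β → ∀ S ∈ 𝒟, (0 : Z2) ∈ S →
      ∃ q ∈ S, |q.1| ≤ R ∧ |q.2| ≤ R ∧ (q.1 : ℝ) + b * q.2 ≤ -ε) :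
    ∃ M L : ℕ, ∀ S ∈ 𝒟, ∀ p ∈ S, |p.2| ≤ M →
      ∃ p' ∈ S, |p'.2| ≤ M ∧ p.1 - L ≤ p'.1 ∧ p'.1 < p.1 := by
  obtain ⟨N₁, R₁, hup⟩ := hup
  obtain ⟨N₂, R₂, hdown⟩ := hdown
  obtain ⟨β, hβ⟩ : ∃ β : ℝ, β = R₁ + R₂ + 3 := ⟨_, rfl⟩
  have hβ0 : 0 < β := by rw [hβ]; positivity
  obtain ⟨ε, hε, R, hleft⟩ := hleft β
  obtain ⟨M, hM⟩ := exists_nat_ge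
    (β * R ^ 2 / ε + β * R₁ ^ 2 + β * R₂ ^ 2 + β * R + R + R₁ + R₂ + 1)
  have h1 : 0 ≤ β * R ^ 2 / ε := by positivity
  have h2 : 0 ≤ β * R₁ ^ 2 := by positivity
  have h3 : 0 ≤ β * R₂ ^ 2 := by positivity
  have h4 : 0 ≤ β * R := by positivity
  have h5 : (0 : ℝ) ≤ R := by positivity
  have h6 : (0 : ℝ) ≤ R₁ := by positivity
  have h7 : (0 : ℝ) ≤ R₂ := by positivity
  have hM0 : (0 : ℝ) < M := by linarith
  obtain ⟨c, hc⟩ : ∃ c : ℝ, c = β / (2 * M) := ⟨_, rfl⟩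
  have hc0 : 0 < c := by rw [hc]; positivity
  have hcM : 2 * c * M = β := by rw [hc]; field_simp
  have hcR : c * R ^ 2 ≤ ε / 2 := by
    rw [hc, div_mul_eq_mul_div, div_le_iff₀ (by positivity)]
    have : β * R ^ 2 / ε ≤ M := by linarith
    rw [div_le_iff₀ hε] at this
    linarith
  have hcR₁ : c * R₁ ^ 2 ≤ 1 := by
    rw [hc, div_mul_eq_mul_div, div_le_iff₀ (by positivity)]; linarith
  have hcR₂ : c * R₂ ^ 2 ≤ 1 := by
    rw [hc, div_mul_eq_mul_div, div_le_iff₀ (by positivity)]; linarith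
  have hcR' : 2 * c * R ≤ 1 := by
    rw [hc, mul_div_assoc', div_mul_eq_mul_div, div_le_iff₀ (by positivity)]; linarith
  have hMR : (R : ℤ) + R₁ + R₂ ≤ M := by
    have : (R : ℝ) + R₁ + R₂ ≤ M := by linarith
    exact_mod_cast this
  obtain ⟨δ, hδ⟩ : ∃ δ : ℝ, δ = min (ε / 2) 1 := ⟨_, rfl⟩
  have hδ0 : 0 < δ := by rw [hδ]; positivity
  have hδ1 : δ ≤ ε / 2 := hδ ▸ min_le_left _ _
  have hδ2 : δ ≤ 1 := hδ ▸ min_le_right _ _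
  obtain ⟨K, hK⟩ : ∃ K : ℕ, K = R + R₁ + R₂ + N₁ + N₂ := ⟨_, rfl⟩
  have expand : ∀ a b : ℝ, c * (a + b) ^ 2 = c * a ^ 2 + 2 * c * a * b + c * b ^ 2 :=
    fun a b => by ring
  have rim : ∀ s : ℝ, s ≤ -(M - R) → 2 * c * s ≤ -(β - 1) := by
    intro s h
    have := mul_le_mul_of_nonneg_left h (by positivity : 0 ≤ 2 * c)
    linarith
  have step : ∀ S ∈ 𝒟, ∀ p ∈ S, |p.2| ≤ M → ∃ p' ∈ S, |p'.2| ≤ M ∧ p.1 - K ≤ p'.1 ∧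
      (p'.1 : ℝ) + c * p'.2 ^ 2 ≤ p.1 + c * p.2 ^ 2 - δ := by
    intro S hS p hp hpM
    have hS' := htrans S hS p
    have h0 : (0 : Z2) ∈ {q | p + q ∈ S} := by simpa using hp
    rw [abs_le] at hpM
    have sq_le : ∀ (a : ℤ) (r : ℕ), |a| ≤ r → c * (a : ℝ) ^ 2 ≤ c * (r : ℝ) ^ 2 := by
      intro a r h
      have h' : |(a : ℝ)| ≤ r := by exact_mod_cast h
      exact mul_le_mul_of_nonneg_left (sq_le_sq.2 (by simpa using h')) hc0.le
    rcases le_or_gt (p.2 + R) M with hhi | hhi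
    · rcases le_or_gt (-M : ℤ) (p.2 - R) with hlo | hlo
      · have hb : |2 * c * (p.2 : ℝ)| ≤ β := by
          rw [← hcM, abs_mul, abs_of_pos (by positivity)]
          refine mul_le_mul_of_nonneg_left ?_ (by positivity)
          have : |p.2| ≤ (M : ℤ) := abs_le.2 hpM
          exact_mod_cast this
        obtain ⟨q, hq, hq1, hq2, hq3⟩ := hleft _ hb _ hS' h0
        have := sq_le q.2 R hq2
        rw [abs_le] at hq1 hq2
        refine ⟨p + q, hq, abs_le.2 ⟨?_, ?_⟩, ?_, ?_⟩
        · simp only [Prod.snd_add]; omega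
        · simp only [Prod.snd_add]; omega
        · simp only [Prod.fst_add]; omega
        · simp only [Prod.fst_add, Prod.snd_add, Int.cast_add]
          rw [expand]
          linarith
      · rcases hup _ hS' h0 with ⟨q, hq, hpos, hq1, hq2⟩ | ⟨k, hk1, hk2, hk⟩
        · have h8 := sq_le q.2 R₁ hq2
          rw [abs_le] at hq1 hq2
          refine ⟨p + q, hq, abs_le.2 ⟨?_, ?_⟩, ?_, ?_⟩
          · simp only [Prod.snd_add]; omega
          · simp only [Prod.snd_add]; omega
          · simp only [Prod.fst_add]; omega
          · simp only [Prod.fst_add, Prod.snd_add, Int.cast_add]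
            have e1 : (q.1 : ℝ) ≤ R₁ := by exact_mod_cast hq1.2
            have e2 : (1 : ℝ) ≤ q.2 := by exact_mod_cast hpos
            have e3 : (p.2 : ℝ) ≤ -(M - R) := by
              have : p.2 ≤ -((M : ℤ) - R) := by omega
              exact_mod_cast this
            have e4 : (R : ℝ) ≤ M := by linarith
            have e5 : (p.2 : ℝ) * q.2 ≤ -(M - R) :=
              (mul_le_mul_of_nonneg_right e3 (by linarith)).trans
                (by linarith [mul_nonneg (sub_nonneg.2 e4) (sub_nonneg.2 e2)])
            linarith [expand p.2 q.2, rim _ e5]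
        · refine ⟨p + (-k, 0), hk, abs_le.2 ⟨?_, ?_⟩, ?_, ?_⟩
          · simp only [Prod.snd_add]; omega
          · simp only [Prod.snd_add]; omega
          · simp only [Prod.fst_add]; omega
          · have : (1 : ℝ) ≤ k := by exact_mod_cast hk1
            simp only [Prod.fst_add, Prod.snd_add, Int.cast_add, Int.cast_neg, add_zero]
            linarith
    · rcases hdown _ hS' h0 with ⟨q, hq, hpos, hq1, hq2⟩ | ⟨k, hk1, hk2, hk⟩
      · have h8 := sq_le q.2 R₂ hq2
        rw [abs_le] at hq1 hq2
        refine ⟨p + q, hq, abs_le.2 ⟨?_, ?_⟩, ?_, ?_⟩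
        · simp only [Prod.snd_add]; omega
        · simp only [Prod.snd_add]; omega
        · simp only [Prod.fst_add]; omega
        · simp only [Prod.fst_add, Prod.snd_add, Int.cast_add]
          have e1 : (q.1 : ℝ) ≤ R₂ := by exact_mod_cast hq1.2
          have e2 : (q.2 : ℝ) ≤ -1 := by
            have : q.2 ≤ -1 := by omega
            exact_mod_cast this
          have e3 : (M - R : ℝ) ≤ p.2 := by
            have : (M : ℤ) - R ≤ p.2 := by omega
            exact_mod_cast this
          have e4 : (R : ℝ) ≤ M := by linarith
          have e5 : (p.2 : ℝ) * q.2 ≤ -(M - R) :=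
            (mul_le_mul_of_nonpos_right e3 (by linarith)).trans
              (by linarith [mul_nonneg (sub_nonneg.2 e4) (sub_nonneg.2 e2)])
          linarith [expand p.2 q.2, rim _ e5]
      · refine ⟨p + (-k, 0), hk, abs_le.2 ⟨?_, ?_⟩, ?_, ?_⟩
        · simp only [Prod.snd_add]; omega
        · simp only [Prod.snd_add]; omega
        · simp only [Prod.fst_add]; omega
        · have : (1 : ℝ) ≤ k := by exact_mod_cast hk1
          simp only [Prod.fst_add, Prod.snd_add, Int.cast_add, Int.cast_neg, add_zero]
          linarith
  have steps : ∀ n : ℕ, ∀ S ∈ 𝒟, ∀ p ∈ S, |p.2| ≤ M → ∃ p' ∈ S, |p'.2| ≤ M ∧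
      p.1 - n * K ≤ p'.1 ∧ (p'.1 : ℝ) + c * p'.2 ^ 2 ≤ p.1 + c * p.2 ^ 2 - n * δ := by
    intro n S hS p hp hpM
    induction n with
    | zero => exact ⟨p, hp, hpM, by simp, by simp⟩
    | succ n ih =>
      obtain ⟨p₁, hp₁, hM₁, hK₁, hφ₁⟩ := ih
      obtain ⟨p₂, hp₂, hM₂, hK₂, hφ₂⟩ := step S hS p₁ hp₁ hM₁
      refine ⟨p₂, hp₂, hM₂, ?_, ?_⟩ <;> push_cast <;> linarith
  obtain ⟨n, hn⟩ := exists_nat_gt (c * M ^ 2 / δ)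
  rw [div_lt_iff₀ hδ0] at hn
  refine ⟨M, n * K, fun S hS p hp hpM => ?_⟩
  obtain ⟨p', hp', hM', hK', hφ⟩ := steps n S hS p hp hpM
  refine ⟨p', hp', hM', by exact_mod_cast hK', ?_⟩
  have e1 : |(p.2 : ℝ)| ≤ M := by exact_mod_cast hpM
  have e2 : c * (p.2 : ℝ) ^ 2 ≤ c * M ^ 2 :=
    mul_le_mul_of_nonneg_left (sq_le_sq.2 (by simpa using e1)) hc0.le
  have e3 : 0 ≤ c * (p'.2 : ℝ) ^ 2 := by positivity
  have : (p'.1 : ℝ) < p.1 := by linarith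
  exact_mod_cast this

end Strip

section Differences

open Filter

variable {A : Type*} {X : Set (Config A)} {w t : Z2}

/-- The sets of points at which two elements of `X` differ, in the coordinates given by the pair
of lattice vectors `w, t`. -/
def diffFamily (X : Set (Config A)) (w t : Z2) : Set (Set Z2) :=
  {S | ∃ x ∈ X, ∃ x' ∈ X, S = {q | x (q.1 • w + q.2 • t) ≠ x' (q.1 • w + q.2 • t)}}

lemma exists_limit [Finite A] (hX : IsSubshift X) (x : ℕ → Config A) (hx : ∀ n, x n ∈ X) :
    ∃ y ∈ X, ∀ p, ∀ᶠ n in (hyperfilter ℕ : Filter ℕ), x n p = y p := by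
  have h : ∀ p, ∃ a, ∀ᶠ n in (hyperfilter ℕ : Filter ℕ), x n p = a := fun p =>
    Ultrafilter.eventually_exists_iff.1 (Eventually.of_forall fun n => ⟨_, rfl⟩)
  choose y hy using h
  refine ⟨y, ?_, hy⟩
  let _ : TopologicalSpace A := ⊥
  refine hX.1.mem_of_tendsto (f := x) (b := (hyperfilter ℕ : Filter ℕ))
    (tendsto_pi_nhds.2 fun p => ?_) (Eventually.of_forall hx)
  exact tendsto_const_nhds.congr' ((hy p).mono fun n h => h.symm)

lemma exists_limit_diffFamily [Finite A] (hX : IsSubshift X) (S : ℕ → Set Z2)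
    (hS : ∀ n, S n ∈ diffFamily X w t) :
    ∃ T ∈ diffFamily X w t, ∀ q, ∀ᶠ n in (hyperfilter ℕ : Filter ℕ), (q ∈ S n ↔ q ∈ T) := by
  choose x hx x' hx' h using hS
  obtain ⟨y, hy, hlim⟩ := exists_limit hX x hx
  obtain ⟨y', hy', hlim'⟩ := exists_limit hX x' hx'
  refine ⟨_, ⟨y, hy, y', hy', rfl⟩, fun q => ?_⟩
  filter_upwards [hlim (q.1 • w + q.2 • t), hlim' (q.1 • w + q.2 • t)] with n h1 h2
  simp only [h n, Set.mem_ofPred_eq, h1, h2]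

lemma translate_mem_diffFamily (hX : IsSubshift X) {S : Set Z2} (hS : S ∈ diffFamily X w t)
    (u : Z2) : {q | u + q ∈ S} ∈ diffFamily X w t := by
  obtain ⟨x, hx, x', hx', rfl⟩ := hS
  refine ⟨_, hX.2 (u.1 • w + u.2 • t) x hx, _, hX.2 (u.1 • w + u.2 • t) x' hx', ?_⟩
  ext q
  have : (u + q).1 • w + (u + q).2 • t = u.1 • w + u.2 • t + (q.1 • w + q.2 • t) := by
    simp only [Prod.fst_add, Prod.snd_add, add_smul]
    abel
  simp only [Set.mem_ofPred_eq, shiftAct, this]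

lemma neg_mem_diffFamily {S : Set Z2} (hS : S ∈ diffFamily X w t) :
    {q | -q ∈ S} ∈ diffFamily X (-w) (-t) := by
  obtain ⟨x, hx, x', hx', rfl⟩ := hS
  exact ⟨x, hx, x', hx', by simp⟩

lemma eq_smul_add_smul (ht : crossZ w t = 1) (p : Z2) :
    p = crossZ p t • w + crossZ w p • t := by
  simp only [crossZ] at *
  ext
  · simp only [Prod.fst_add, Prod.smul_fst, smul_eq_mul]
    linear_combination -p.1 * ht
  · simp only [Prod.snd_add, Prod.smul_snd, smul_eq_mul]
    linear_combination -p.2 * ht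

lemma toR2_mem_leftHalfPlane (v p : Z2) : toR2 p ∈ leftHalfPlane (toR2 v) ↔ 0 ≤ crossZ v p := by
  simp only [leftHalfPlane, toR2, crossZ, Set.mem_ofPred_eq]
  exact_mod_cast Iff.rfl

lemma ExpansiveRay.exists_mem_le (ht : crossZ w t = 1) {b : ℝ}
    (h : ExpansiveRay X (toR2 t - b • toR2 w)) {S : Set Z2} (hS : S ∈ diffFamily X w t)
    (hne : S.Nonempty) : ∃ q ∈ S, (q.1 : ℝ) + b * q.2 ≤ 0 := by
  obtain ⟨x, hx, x', hx', rfl⟩ := hS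
  obtain ⟨q₀, hq₀⟩ := hne
  by_contra! hcon
  refine hq₀ (h x hx x' hx' (fun p hp => ?_) _ trivial)
  by_contra hne
  have e := eq_smul_add_smul ht p
  rw [e] at hne
  have := hcon (crossZ p t, crossZ w p) hne
  simp only [leftHalfPlane, toR2, Set.mem_ofPred_eq, Prod.fst_sub, Prod.snd_sub, Prod.smul_fst,
    Prod.smul_snd, smul_eq_mul] at hp
  simp only [crossZ] at this
  push_cast at this
  linarith

lemma ExpansiveRay.closingRay {v : Z2} (h : ExpansiveRay X (toR2 v)) : ClosingRay X v :=
  ⟨0, fun _ _ _ _ x hx x' hx' hxx' p _ =>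
    h x hx x' hx' (fun p hp => hxx' p (Or.inl hp)) p trivial⟩

lemma ClosingRay.exists_notMem (h : ClosingRay X w) (ht : crossZ w t = 1) :
    ∃ N : ℕ, ∀ S ∈ diffFamily X w t, ∀ s : ℤ, (∀ q ∈ S, q.2 < 0) →
      (∀ k : ℕ, k < N → ((s + k, -1) : Z2) ∉ S) → ∀ a : ℤ, ((a, -1) : Z2) ∉ S := by
  obtain ⟨N, hN⟩ := h
  have hcross : ∀ a : ℤ, crossZ w (a • w - t) = -1 := by
    intro a
    simp only [crossZ, Prod.fst_sub, Prod.snd_sub, Prod.smul_fst, Prod.smul_snd,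
      smul_eq_mul] at *
    linear_combination -ht
  refine ⟨N, ?_⟩
  rintro _ ⟨x, hx, x', hx', rfl⟩ s hneg hblock a ha
  refine ha (hN (s • w - t) (hcross s) N le_rfl x hx x' hx' ?_ _ ?_)
  · rintro p (hp | ⟨k, hk, hkp⟩)
    · rw [toR2_mem_leftHalfPlane] at hp
      by_contra hne
      rw [eq_smul_add_smul ht p] at hne
      have := hneg (crossZ p t, crossZ w p) hne
      exact absurd hp (not_le.2 this)
    · have hinj : p = s • w - t + (k : ℤ) • w := by
        simp only [toR2, Prod.mk.injEq, Int.cast_inj] at hkp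
        exact (Prod.ext hkp.1 hkp.2).symm
      have := hblock k hk
      simp only [Set.mem_ofPred_eq, not_not, add_smul, neg_smul, one_smul] at this
      rw [hinj, show s • w - t + (k : ℤ) • w = s • w + (k : ℤ) • w + -t by abel]
      exact this
  · have := hcross a
    simp only [lineL0, toR2, Set.mem_ofPred_eq]
    simp only [neg_smul, one_smul, ← sub_eq_add_neg]
    simp only [crossZ] at this
    exact_mod_cast this

lemma ClosingRay.exists_mem_above [Finite A] (hX : IsSubshift X) (h : ClosingRay X w)
    (ht : crossZ w t = 1) : ∃ N : ℕ, ∀ s : ℤ, ∃ R : ℕ, ∀ S ∈ diffFamily X w t, (0 : Z2) ∈ S →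
      (∃ q ∈ S, 0 < q.2 ∧ |q.1| ≤ R ∧ |q.2| ≤ R) ∨ ∃ k : ℕ, k < N ∧ ((s + k, 0) : Z2) ∈ S := by
  obtain ⟨N, hN⟩ := h.exists_notMem ht
  refine ⟨N, fun s => ?_⟩
  by_contra! hcon
  choose S hS h0 habove hblock using hcon
  obtain ⟨T, hT, hlim⟩ := exists_limit_diffFamily hX S hS
  have hT0 : (0 : Z2) ∈ T := by
    obtain ⟨n, hn⟩ := (hlim 0).exists
    exact hn.1 (h0 n)
  refine hN _ (translate_mem_diffFamily hX hT (0, 1)) s ?_ ?_ 0 ?_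
  · intro q hq
    by_contra hq2
    have hlarge : ∀ᶠ n : ℕ in (hyperfilter ℕ : Filter ℕ), |q.1| + |1 + q.2| ≤ (n : ℤ) := by
      refine Nat.hyperfilter_le_atTop ?_
      filter_upwards [eventually_ge_atTop (|q.1| + |1 + q.2|).toNat] with n hn
      omega
    obtain ⟨n, hn1, hn2⟩ := (hlarge.and (hlim ((0, 1) + q))).exists
    have h1 := abs_nonneg q.1
    have h2 := abs_nonneg (1 + q.2)
    have h3 := habove n _ (hn2.2 hq) (by simp only [Prod.snd_add]; omega)
      (by simp only [Prod.fst_add, zero_add]; omega)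
    simp only [Prod.snd_add] at h3
    omega
  · intro k hk hmem
    obtain ⟨n, hn⟩ := (hlim ((s + k, 0) : Z2)).exists
    refine hblock n k hk (hn.2 ?_)
    simpa using hmem
  · change ((0, 1) + (0, -1) : Z2) ∈ T
    exact hT0

lemma exists_mem_left [Finite A] (hX : IsSubshift X) (ht : crossZ w t = 1)
    (hexp : ∀ b : ℝ, ExpansiveRay X (toR2 t - b • toR2 w)) (β : ℝ) :
    ∃ ε > 0, ∃ R : ℕ, ∀ b : ℝ, |b| ≤ β → ∀ S ∈ diffFamily X w t, (0 : Z2) ∈ S →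
      ∃ q ∈ S, |q.1| ≤ R ∧ |q.2| ≤ R ∧ (q.1 : ℝ) + b * q.2 ≤ -ε := by
  by_contra! hcon
  have hcon' := fun n : ℕ => hcon (1 / (n + 1)) Nat.one_div_pos_of_nat n
  choose b hb S hS h0 hleft using hcon'
  obtain ⟨T, hT, hlim⟩ := exists_limit_diffFamily hX S hS
  obtain ⟨b₀, -, hb₀⟩ := (isCompact_Icc (a := -β) (b := β)).ultrafilter_le_nhds
    ((hyperfilter ℕ).map b) (tendsto_principal.2 (Eventually.of_forall fun n => abs_le.1 (hb n)))
  have hb₀ : Tendsto b (hyperfilter ℕ : Filter ℕ) (nhds b₀) := hb₀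
  have hT0 : (0 : Z2) ∈ T := by
    obtain ⟨n, hn⟩ := (hlim 0).exists
    exact hn.1 (h0 n)
  have hnonneg : ∀ q ∈ T, 0 ≤ (q.1 : ℝ) + b₀ * q.2 := by
    intro q hq
    have hε : Tendsto (fun n : ℕ => -(1 / ((n : ℝ) + 1))) (hyperfilter ℕ : Filter ℕ) (nhds 0) := by
      have := (tendsto_one_div_add_atTop_nhds_zero_nat (𝕜 := ℝ)).neg
      rw [neg_zero] at this
      exact this.mono_left Nat.hyperfilter_le_atTop
    have hlin : Tendsto (fun n => (q.1 : ℝ) + b n * q.2) (hyperfilter ℕ : Filter ℕ)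
        (nhds (q.1 + b₀ * q.2)) := tendsto_const_nhds.add (hb₀.mul_const _)
    refine le_of_tendsto_of_tendsto hε hlin ?_
    have hlarge : ∀ᶠ n : ℕ in (hyperfilter ℕ : Filter ℕ), |q.1| + |q.2| ≤ (n : ℤ) := by
      refine Nat.hyperfilter_le_atTop ?_
      filter_upwards [eventually_ge_atTop (|q.1| + |q.2|).toNat] with n hn
      omega
    filter_upwards [hlarge, hlim q] with n hn1 hn2
    have h1 := abs_nonneg q.1
    have h2 := abs_nonneg q.2
    exact (hleft n q (hn2.2 hq) (by omega) (by omega)).le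
  obtain ⟨q, hq, hle⟩ := (hexp b₀).exists_mem_le ht (translate_mem_diffFamily hX hT (-1, 0))
    ⟨(1, 0), show ((-1, 0) + (1, 0) : Z2) ∈ T from hT0⟩
  have := hnonneg _ hq
  simp only [Prod.fst_add, Prod.snd_add, zero_add] at this
  push_cast at this
  linarith

/-- If the rays directed by `w` and `-w` are closing and all rays on the left of `w` are expansive,
then some positive multiple of `w` is a period of all elements of `X`. -/
lemma exists_period [Finite A] (hX : IsSubshift X) (ht : crossZ w t = 1) (hw : ClosingRay X w)
    (hw' : ClosingRay X (-w)) (hexp : ∀ b : ℝ, ExpansiveRay X (toR2 t - b • toR2 w)) :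
    ∃ P : ℕ, 0 < P ∧ ∀ x ∈ X, ∀ p, x (p + (P : ℤ) • w) = x p := by
  have ht' : crossZ (-w) (-t) = 1 := by simpa [crossZ] using ht
  obtain ⟨M, L, hML⟩ := exists_strip (𝒟 := diffFamily X w t)
    (fun S hS u => translate_mem_diffFamily hX hS u)
    (by
      obtain ⟨N, hN⟩ := hw.exists_mem_above hX ht
      obtain ⟨R, hR⟩ := hN (-N)
      refine ⟨N, R, fun S hS h0 => (hR S hS h0).imp_right ?_⟩
      rintro ⟨k, hk, hmem⟩
      exact ⟨N - k, by omega, by omega, by convert hmem using 2; ring⟩)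
    (by
      obtain ⟨N, hN⟩ := hw'.exists_mem_above hX ht'
      obtain ⟨R, hR⟩ := hN 1
      refine ⟨N, R, fun S hS h0 => (hR _ (neg_mem_diffFamily hS) (by simpa using h0)).imp ?_ ?_⟩
      · rintro ⟨q, hq, h1, h2, h3⟩
        exact ⟨-q, hq, by simpa using h1, by simpa using h2, by simpa using h3⟩
      · rintro ⟨k, hk, hmem⟩
        exact ⟨1 + k, by omega, by omega, by simpa using hmem⟩)
    (exists_mem_left hX ht hexp)
  let F : Finset Z2 := Finset.Icc (-(L : ℤ)) (-1) ×ˢ Finset.Icc (-(M : ℤ)) M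
  have hF : ∀ S ∈ diffFamily X w t, (∀ q ∈ F, q ∉ S) →
      ∀ n : ℕ, ∀ q ∈ S, q.1 ≤ n → |q.2| ≤ M → q.1 < 0 := by
    intro S hS hdisj n
    induction n with
    | zero =>
      intro q hq hle hM
      by_contra hnn
      obtain ⟨q', hq', h1, h2, h3⟩ := hML S hS q hq hM
      refine hdisj q' ?_ hq'
      rw [abs_le] at h1
      simp only [F, Finset.mem_product, Finset.mem_Icc]
      omega
    | succ n ih =>
      intro q hq hle hM
      by_contra hnn
      obtain ⟨q', hq', h1, h2, h3⟩ := hML S hS q hq hM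
      have := ih q' hq' (by omega) h1
      refine hdisj q' ?_ hq'
      rw [abs_le] at h1
      simp only [F, Finset.mem_product, Finset.mem_Icc]
      omega
  have := Fintype.ofFinite A
  classical
  obtain ⟨K, hK⟩ : ∃ K, K = Fintype.card (F → A) := ⟨_, rfl⟩
  have key : ∀ x ∈ X, x ((K : ℤ) • w + (K.factorial : ℤ) • w) = x ((K : ℤ) • w) := by
    intro x hx
    obtain ⟨i, j, hlt, hij⟩ : ∃ i j : Fin (K + 1), i < j ∧
        (fun q : F => x ((i : ℤ) • w + (q.1.1 • w + q.1.2 • t))) =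
          fun q : F => x ((j : ℤ) • w + (q.1.1 • w + q.1.2 • t)) := by
      obtain ⟨i, j, hne, hij⟩ := Fintype.exists_ne_map_eq_of_card_lt
        (fun (i : Fin (K + 1)) (q : F) => x ((i : ℤ) • w + (q.1.1 • w + q.1.2 • t)))
        (by rw [← hK, Fintype.card_fin]; exact Nat.lt_succ_self K)
      rcases lt_or_gt_of_ne hne with h | h
      exacts [⟨i, j, h, hij⟩, ⟨j, i, h, hij.symm⟩]
    have hright : ∀ r : ℕ, x ((i : ℤ) • w + (r : ℤ) • w) = x ((j : ℤ) • w + (r : ℤ) • w) := by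
      intro r
      by_contra hne
      have hlt := hF _ ⟨_, hX.2 ((i : ℤ) • w) x hx, _, hX.2 ((j : ℤ) • w) x hx, rfl⟩ ?_ r (r, 0)
        (by simpa [shiftAct] using hne) le_rfl (by simp)
      · exact absurd hlt (by simp)
      · intro q hq
        simp only [Set.mem_ofPred_eq, not_not, shiftAct]
        exact congrFun hij ⟨q, hq⟩
    obtain ⟨d, hd⟩ : ∃ d : ℕ, (j : ℕ) = i + d := ⟨j - i, by have := Fin.lt_def.1 hlt; omega⟩
    have hd0 : 0 < d := by have := Fin.lt_def.1 hlt; omega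
    have hdK : d ≤ K := by have := j.2; omega
    have hiK : (i : ℕ) ≤ K := by have := i.2; omega
    have hiter : ∀ m : ℕ, x ((K : ℤ) • w + ((m * d : ℕ) : ℤ) • w) = x ((K : ℤ) • w) := by
      intro m
      induction m with
      | zero => simp
      | succ m ih =>
        rw [← ih]
        have := hright (K - i + m * d)
        rw [← add_smul, ← add_smul, hd] at this
        rw [← add_smul, ← add_smul]
        convert this.symm using 3
        · push_cast [hiK]; ring
        · push_cast [hiK]; ring
    obtain ⟨m, hm⟩ := Nat.dvd_factorial hd0 hdK
    rw [hm, mul_comm]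
    exact hiter m
  refine ⟨K.factorial, Nat.factorial_pos K, fun x hx p => ?_⟩
  have := key _ (hX.2 (p - (K : ℤ) • w) x hx)
  simp only [shiftAct] at this
  rw [sub_add_cancel, ← add_assoc, sub_add_cancel] at this
  exact this

lemma ExpansiveRay.of_period {P : ℕ} (hP : 0 < P)
    (hper : ∀ x ∈ X, ∀ p, x (p + (P : ℤ) • w) = x p) {v : Z2} (hv : crossZ v w ≠ 0) :
    ExpansiveRay X (toR2 v) := by
  intro x hx x' hx' hxx' p _
  have hiter : ∀ y ∈ X, ∀ k : ℤ, y (p + k • ((P : ℤ) • w)) = y p := fun y hy k =>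
    Function.Periodic.zsmul (hper y hy) k p
  obtain ⟨k, hk⟩ : ∃ k : ℤ, 0 ≤ crossZ v p + k * (P * crossZ v w) := by
    refine ⟨-(crossZ v p * (P * crossZ v w)) + |crossZ v p| * (P * crossZ v w) +
      crossZ v p * (P * crossZ v w), ?_⟩
    have h1 : (1 : ℤ) ≤ (P * crossZ v w) ^ 2 := by
      have : (P : ℤ) * crossZ v w ≠ 0 := mul_ne_zero (by exact_mod_cast hP.ne') hv
      have := sq_pos_of_ne_zero this
      omega
    nlinarith [neg_abs_le (crossZ v p), abs_nonneg (crossZ v p)]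
  rw [← hiter x hx k, ← hiter x' hx' k]
  refine hxx' _ ((toR2_mem_leftHalfPlane _ _).2 ?_)
  convert hk using 1
  simp only [crossZ, Prod.fst_add, Prod.snd_add, Prod.smul_fst, Prod.smul_snd, smul_eq_mul]
  ring

lemma finite_of_periods [Finite A] {P Q : ℕ} (hP : 0 < P) (hQ : 0 < Q)
    (h1 : ∀ x ∈ X, ∀ p, x (p + (P : ℤ) • ((1, 0) : Z2)) = x p)
    (h2 : ∀ x ∈ X, ∀ p, x (p + (Q : ℤ) • ((0, 1) : Z2)) = x p) : X.Finite := by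
  have hP' : (0 : ℤ) < P := by exact_mod_cast hP
  have hQ' : (0 : ℤ) < Q := by exact_mod_cast hQ
  have hmod : ∀ x ∈ X, ∀ p : Z2, x (p.1 % P, p.2 % Q) = x p := by
    intro x hx p
    rw [← Function.Periodic.zsmul (h1 x hx) (p.1 / P) (p.1 % P, p.2 % Q),
      ← Function.Periodic.zsmul (h2 x hx) (p.2 / Q)]
    congr 1
    ext
    · simp [Int.emod_add_mul_ediv, mul_comm]
    · simp [Int.emod_add_mul_ediv, mul_comm]
  have hinj : Function.Injective
      fun (x : X) (i : Fin P) (j : Fin Q) => (x : Config A) ((i : ℤ), (j : ℤ)) := by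
    intro x y hxy
    refine Subtype.ext (funext fun p => ?_)
    have e1 := Int.emod_nonneg p.1 hP'.ne'
    have e2 := Int.emod_lt_of_pos p.1 hP'
    have e3 := Int.emod_nonneg p.2 hQ'.ne'
    have e4 := Int.emod_lt_of_pos p.2 hQ'
    have := congrFun (congrFun hxy ⟨(p.1 % P).toNat, by omega⟩) ⟨(p.2 % Q).toNat, by omega⟩
    simp only [Int.toNat_of_nonneg e1, Int.toNat_of_nonneg e3] at this
    rw [← hmod x x.2, ← hmod y y.2, this]
  exact Set.finite_coe_iff.1 (Finite.of_injective _ hinj)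

end Differences

section Directions

variable {A : Type*} {X : Set (Config A)} {D : Finset Z2}

lemma crossZ_smul_left (c : ℤ) (u v : Z2) : crossZ (c • u) v = c * crossZ u v := by
  simp only [crossZ, Prod.smul_fst, Prod.smul_snd, smul_eq_mul]
  ring

lemma toR2_smul (c : ℤ) (u : Z2) : toR2 (c • u) = (c : ℝ) • toR2 u := by
  ext <;> simp [toR2]

lemma toR2_neg (u : Z2) : toR2 (-u) = -toR2 u := by
  ext <;> simp [toR2]

lemma toR2_ne_zero {u : Z2} (hu : u ≠ 0) : toR2 u ≠ 0 := by
  intro h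
  simp only [toR2, Prod.mk_eq_zero, Int.cast_eq_zero] at h
  exact hu (Prod.ext h.1 h.2)

lemma ne_zero_of_gcd {u : Z2} (hu : Int.gcd u.1 u.2 = 1) : u ≠ 0 := by
  rintro rfl
  simp at hu

lemma exists_crossZ_eq_one {u : Z2} (hu : Int.gcd u.1 u.2 = 1) : ∃ t, crossZ u t = 1 := by
  refine ⟨(-Int.gcdB u.1 u.2, Int.gcdA u.1 u.2), ?_⟩
  have := Int.gcd_eq_gcd_ab u.1 u.2
  rw [hu] at this
  simp only [crossZ]
  push_cast at this
  linarith

lemma eq_smul_of_crossZ_eq_zero {u v : Z2} (hu : Int.gcd u.1 u.2 = 1) (h : crossZ u v = 0) :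
    ∃ c : ℤ, v = c • u := by
  obtain ⟨t, ht⟩ := exists_crossZ_eq_one hu
  refine ⟨crossZ v t, ?_⟩
  have := eq_smul_add_smul ht v
  rwa [h, zero_smul, add_zero] at this

lemma eq_or_eq_neg_of_crossZ_eq_zero {u v : Z2} (hu : Int.gcd u.1 u.2 = 1)
    (hv : Int.gcd v.1 v.2 = 1) (h : crossZ u v = 0) : v = u ∨ v = -u := by
  obtain ⟨c, rfl⟩ := eq_smul_of_crossZ_eq_zero hu h
  rw [Prod.smul_fst, Prod.smul_snd, smul_eq_mul, smul_eq_mul, Int.gcd_mul_left, hu, mul_one,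
    Int.natAbs_eq_iff] at hv
  rcases hv with h | h <;> simp [h]

lemma SameRay.crossZ_pos {v : Z2} (hv : v ≠ 0) {u : ℝ × ℝ} (hu : u ≠ 0)
    (h : SameRay ℝ (toR2 v) u) {w : Z2} (hw : 0 < crossR (toR2 w) u) : 0 < crossZ w v := by
  obtain ⟨r, s, hr, hs, hrs⟩ := h.exists_pos (toR2_ne_zero hv) hu
  have : r * (crossZ w v : ℝ) = s * crossR (toR2 w) u := by
    have h1 := congrArg Prod.fst hrs
    have h2 := congrArg Prod.snd hrs
    simp only [toR2, Prod.smul_fst, Prod.smul_snd, smul_eq_mul] at h1 h2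
    simp only [crossZ, crossR, toR2]
    push_cast
    linear_combination (w.1 : ℝ) * h2 - w.2 * h1
  have h3 : 0 < r * (crossZ w v : ℝ) := this ▸ mul_pos hs hw
  exact_mod_cast pos_of_mul_pos_right h3 hr.le

lemma eq_of_sameRay {u v : Z2} (hu : Int.gcd u.1 u.2 = 1) (hv : Int.gcd v.1 v.2 = 1)
    (h : SameRay ℝ (toR2 u) (toR2 v)) : u = v := by
  have hu0 := toR2_ne_zero (ne_zero_of_gcd hu)
  obtain ⟨r, s, hr, hs, hrs⟩ := h.exists_pos hu0 (toR2_ne_zero (ne_zero_of_gcd hv))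
  have hcross : crossZ u v = 0 := by
    have h1 := congrArg Prod.fst hrs
    have h2 := congrArg Prod.snd hrs
    simp only [toR2, Prod.smul_fst, Prod.smul_snd, smul_eq_mul] at h1 h2
    have : s * (crossZ u v : ℝ) = 0 := by
      simp only [crossZ]
      push_cast
      linear_combination (u.2 : ℝ) * h1 - u.1 * h2
    exact_mod_cast (mul_eq_zero.1 this).resolve_left hs.ne'
  rcases eq_or_eq_neg_of_crossZ_eq_zero hu hv hcross with h | rfl
  · exact h.symm
  · rw [toR2_neg, smul_neg, ← neg_smul] at hrs
    have := smul_left_injective ℝ hu0 hrs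
    linarith

lemma ExpansiveRay.of_smul {c : ℝ} (hc : 0 < c) {u : ℝ × ℝ} (h : ExpansiveRay X (c • u)) :
    ExpansiveRay X u := by
  have : leftHalfPlane (c • u) = leftHalfPlane u := by
    ext p
    simp only [leftHalfPlane, Set.mem_ofPred_eq, Prod.smul_fst, Prod.smul_snd, smul_eq_mul]
    rw [show c * u.1 * p.2 - c * u.2 * p.1 = c * (u.1 * p.2 - u.2 * p.1) by ring,
      mul_nonneg_iff_of_pos_left hc]
  rwa [ExpansiveRay, this] at h

lemma NonexpansiveDirSet.closingRay (hD : NonexpansiveDirSet X D) (hcl : ∀ v ∈ D, ClosingRay X v)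
    {w : Z2} (hw : Int.gcd w.1 w.2 = 1) : ClosingRay X w := by
  by_cases h : ExpansiveRay X (toR2 w)
  · exact h.closingRay
  · obtain ⟨v, hv, hvw⟩ := hD.2.2 _ (toR2_ne_zero (ne_zero_of_gcd hw)) h
    exact eq_of_sameRay (hD.1 v hv) hw hvw ▸ hcl v hv

lemma crossR_toR2_sub_smul {w t : Z2} (ht : crossZ w t = 1) (b : ℝ) :
    crossR (toR2 w) (toR2 t - b • toR2 w) = 1 := by
  have : (crossZ w t : ℝ) = 1 := by exact_mod_cast ht
  simp only [crossZ] at this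
  push_cast at this
  simp only [crossR, toR2, Prod.fst_sub, Prod.snd_sub, Prod.smul_fst, Prod.smul_snd, smul_eq_mul]
  linear_combination this

lemma toR2_sub_smul_ne_zero {w t : Z2} (ht : crossZ w t = 1) (b : ℝ) :
    toR2 t - b • toR2 w ≠ 0 := by
  intro h
  have := crossR_toR2_sub_smul ht b
  rw [h] at this
  simp [crossR] at this

/-- If no nonexpansive ray points to the left of `w`, then all nonexpansive rays are parallel
to `w`. -/
lemma NonexpansiveDirSet.crossZ_eq_zero [Finite A] (hX : IsSubshift X)
    (hD : NonexpansiveDirSet X D) (hcl : ∀ v ∈ D, ClosingRay X v) {w : Z2} (hw : w ≠ 0)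
    (h : ∀ v ∈ D, crossZ w v ≤ 0) : ∀ v ∈ D, crossZ w v = 0 := by
  have hg : 0 < Int.gcd w.1 w.2 := by
    refine Nat.pos_of_ne_zero fun h0 => hw ?_
    rw [Int.gcd_eq_zero_iff] at h0
    exact Prod.ext h0.1 h0.2
  obtain ⟨a, b, hab, ha, hb⟩ := Int.exists_gcd_one hg
  obtain ⟨g, hg', w₀, hw₀, rfl⟩ : ∃ g : ℤ, 0 < g ∧ ∃ w₀ : Z2, Int.gcd w₀.1 w₀.2 = 1 ∧
      w = g • w₀ := by
    refine ⟨Int.gcd w.1 w.2, by exact_mod_cast hg, (a, b), hab, Prod.ext ?_ ?_⟩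
    · simpa [mul_comm] using ha
    · simpa [mul_comm] using hb
  obtain ⟨t, ht⟩ := exists_crossZ_eq_one hw₀
  have hexp : ∀ b : ℝ, ExpansiveRay X (toR2 t - b • toR2 w₀) := by
    intro b
    by_contra hne
    obtain ⟨v, hv, hray⟩ := hD.2.2 _ (toR2_sub_smul_ne_zero ht b) hne
    have hpos := SameRay.crossZ_pos (ne_zero_of_gcd (hD.1 v hv)) (toR2_sub_smul_ne_zero ht b) hray
      (w := w₀) (by rw [crossR_toR2_sub_smul ht]; exact one_pos)
    have := h v hv
    rw [crossZ_smul_left] at this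
    exact absurd this (not_le.2 (mul_pos hg' hpos))
  obtain ⟨P, hP, hper⟩ := exists_period hX ht (hD.closingRay hcl hw₀)
    (hD.closingRay hcl (by simpa using hw₀)) hexp
  intro v hv
  by_contra hne
  refine hD.2.1 v hv (ExpansiveRay.of_period hP hper fun h0 => hne ?_)
  rw [crossZ_smul_left, show crossZ w₀ v = -crossZ v w₀ by simp only [crossZ]; ring, h0]
  simp

lemma finite_of_expansiveRay [Finite A] (hX : IsSubshift X)
    (h : ∀ u : ℝ × ℝ, u ≠ 0 → ExpansiveRay X u) : X.Finite := by
  have hper : ∀ w t : Z2, crossZ w t = 1 →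
      ∃ P : ℕ, 0 < P ∧ ∀ x ∈ X, ∀ p, x (p + (P : ℤ) • w) = x p := by
    intro w t ht
    have hw : w ≠ 0 := by
      rintro rfl
      simp [crossZ] at ht
    exact exists_period hX ht (h _ (toR2_ne_zero hw)).closingRay
      (h _ (toR2_ne_zero (neg_ne_zero.2 hw))).closingRay
      fun b => h _ (toR2_sub_smul_ne_zero ht b)
  obtain ⟨P, hP, h1⟩ := hper (1, 0) (0, 1) (by simp [crossZ])
  obtain ⟨Q, hQ, h2⟩ := hper (0, 1) (-1, 0) (by simp [crossZ])
  exact finite_of_periods hP hQ h1 h2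

lemma NonexpansiveDirSet.exists_crossZ_pos_of_expansive [Finite A] (hX : IsSubshift X)
    (hInf : X.Infinite) (hD : NonexpansiveDirSet X D) (hcl : ∀ v ∈ D, ClosingRay X v) {w : Z2}
    (hw : w ≠ 0) (h1 : ExpansiveRay X (toR2 w)) (h2 : ExpansiveRay X (-toR2 w)) :
    ∃ v ∈ D, 0 < crossZ w v := by
  by_contra! hcon
  have h0 := hD.crossZ_eq_zero hX hcl hw hcon
  refine hInf (finite_of_expansiveRay hX fun u hu => ?_)
  by_contra hne
  obtain ⟨v, hv, -⟩ := hD.2.2 u hu hne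
  obtain ⟨c, rfl⟩ := eq_smul_of_crossZ_eq_zero (hD.1 v hv) (v := w) (by
    rw [show crossZ v w = -crossZ w v by simp only [crossZ]; ring, h0 v hv, neg_zero])
  rw [toR2_smul] at h1 h2
  rw [← neg_smul] at h2
  rcases lt_trichotomy c 0 with hc | rfl | hc
  · exact hD.2.1 v hv (h2.of_smul (neg_pos.2 (by exact_mod_cast hc)))
  · simp at hw
  · exact hD.2.1 v hv (h1.of_smul (by exact_mod_cast hc))

lemma NonexpansiveDirSet.neg_eq_of_eq_pair [Finite A] (hX : IsSubshift X)
    (hD : NonexpansiveDirSet X D) (hcl : ∀ v ∈ D, ClosingRay X v) {a b : Z2} (hab : a ≠ b)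
    (h : D = {a, b}) : b = -a := by
  have ha : a ∈ D := by simp [h]
  have hb : b ∈ D := by simp [h]
  suffices h0 : crossZ a b = 0 from
    (eq_or_eq_neg_of_crossZ_eq_zero (hD.1 a ha) (hD.1 b hb) h0).resolve_left hab.symm
  have e1 : crossZ (a - b) a = crossZ a b := by
    simp only [crossZ, Prod.fst_sub, Prod.snd_sub]; ring
  have e2 : crossZ (a - b) b = crossZ a b := by
    simp only [crossZ, Prod.fst_sub, Prod.snd_sub]; ring
  have e3 : crossZ (b - a) a = -crossZ a b := by
    simp only [crossZ, Prod.fst_sub, Prod.snd_sub]; ring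
  have e4 : crossZ (b - a) b = -crossZ a b := by
    simp only [crossZ, Prod.fst_sub, Prod.snd_sub]; ring
  rcases le_total (crossZ a b) 0 with hle | hle
  · rw [← e1]
    refine hD.crossZ_eq_zero hX hcl (sub_ne_zero.2 hab) ?_ a ha
    simp [h, e1, e2, hle]
  · rw [← neg_eq_zero, ← e3]
    refine hD.crossZ_eq_zero hX hcl (sub_ne_zero.2 hab.symm) ?_ a ha
    simp [h, e3, e4, hle]

lemma NonexpansiveDirSet.exists_crossZ_pos [Finite A] (hX : IsSubshift X)
    (hD : NonexpansiveDirSet X D) (hcl : ∀ v ∈ D, ClosingRay X v) (hcard : 3 ≤ D.card) {w : Z2}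
    (hw : w ≠ 0) : ∃ v ∈ D, 0 < crossZ w v := by
  by_contra! hcon
  have h0 := hD.crossZ_eq_zero hX hcl hw hcon
  obtain ⟨v₀, hv₀⟩ : D.Nonempty := Finset.card_pos.1 (by omega)
  obtain ⟨c, rfl⟩ := eq_smul_of_crossZ_eq_zero (hD.1 v₀ hv₀) (v := w) (by
    rw [show crossZ v₀ w = -crossZ w v₀ by simp only [crossZ]; ring, h0 v₀ hv₀, neg_zero])
  have hc : c ≠ 0 := by
    rintro rfl
    simp at hw
  have hsub : D ⊆ {v₀, -v₀} := by
    intro v hv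
    have := h0 v hv
    rw [crossZ_smul_left] at this
    simpa using eq_or_eq_neg_of_crossZ_eq_zero (hD.1 v₀ hv₀) (hD.1 v hv)
      ((mul_eq_zero.1 this).resolve_left hc)
  have := (Finset.card_le_card hsub).trans Finset.card_le_two
  omega

end Directions

section Polygons

variable {D : Finset Z2}

lemma exists_nonneg_combination (hne : ∀ v ∈ D, v ≠ 0)
    (h : ∀ w : Z2, w ≠ 0 → ∃ v ∈ D, 0 < crossZ w v) {v : Z2} (hv : v ∈ D) :
    ∃ c : Z2 → ℤ, (∀ u, 0 ≤ c u) ∧ 0 < c v ∧ ∑ u ∈ D, c u • u = 0 := by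
  obtain ⟨a₀, ha₀, hpos₀⟩ := h v (hne v hv)
  obtain ⟨a, ha, hmin⟩ := (D.filter fun a => 0 < crossZ v a).exists_min_image
    (fun a => ((v.1 * a.1 + v.2 * a.2 : ℤ) : ℚ) / crossZ v a)
    ⟨a₀, Finset.mem_filter.2 ⟨ha₀, hpos₀⟩⟩
  rw [Finset.mem_filter] at ha
  obtain ⟨b, hb, hab⟩ := h a (hne a ha.1)
  have hvb : crossZ v b ≤ 0 := by
    by_contra! hlt
    have hle := hmin b (Finset.mem_filter.2 ⟨hb, hlt⟩)
    rw [div_le_div_iff₀ (by exact_mod_cast ha.2) (by exact_mod_cast hlt)] at hle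
    have hle' : (v.1 * a.1 + v.2 * a.2) * crossZ v b ≤ (v.1 * b.1 + v.2 * b.2) * crossZ v a := by
      exact_mod_cast hle
    have hid : (v.1 * a.1 + v.2 * a.2) * crossZ v b - (v.1 * b.1 + v.2 * b.2) * crossZ v a =
        (v.1 ^ 2 + v.2 ^ 2) * crossZ a b := by
      simp only [crossZ]; ring
    have hsq : 0 < v.1 ^ 2 + v.2 ^ 2 := by
      by_contra! hle
      refine hne v hv (Prod.ext ?_ ?_)
      · exact pow_eq_zero_iff (two_ne_zero) |>.1 (by nlinarith [sq_nonneg v.1, sq_nonneg v.2])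
      · exact pow_eq_zero_iff (two_ne_zero) |>.1 (by nlinarith [sq_nonneg v.1, sq_nonneg v.2])
    have := mul_pos hsq hab
    omega
  refine ⟨fun u => (if u = v then crossZ a b else 0) + (if u = a then -crossZ v b else 0) +
    (if u = b then crossZ v a else 0), fun u => ?_, ?_, ?_⟩
  · have := hab.le
    have := ha.2.le
    have := neg_nonneg.2 hvb
    positivity
  · have := ha.2.le
    have := neg_nonneg.2 hvb
    simp only [if_true]
    positivity
  · simp only [add_smul, Finset.sum_add_distrib, ite_smul, zero_smul, Finset.sum_ite_eq', hv, ha.1,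
      hb, if_true]
    ext
    · simp only [crossZ, Prod.fst_add, Prod.smul_fst, smul_eq_mul, Prod.fst_zero]; ring
    · simp only [crossZ, Prod.snd_add, Prod.smul_snd, smul_eq_mul, Prod.snd_zero]; ring

lemma exists_pos_combination (hne : ∀ v ∈ D, v ≠ 0)
    (h : ∀ w : Z2, w ≠ 0 → ∃ v ∈ D, 0 < crossZ w v) :
    ∃ c : Z2 → ℤ, (∀ v ∈ D, 0 < c v) ∧ ∑ v ∈ D, c v • v = 0 := by
  choose! c hc0 hcpos hcsum using fun v (hv : v ∈ D) => exists_nonneg_combination hne h hv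
  refine ⟨fun u => ∑ v ∈ D, c v u, fun u hu => ?_, ?_⟩
  · exact Finset.sum_pos' (fun v hv => hc0 v hv u) ⟨u, hu, hcpos u hu⟩
  · simp only [Finset.sum_smul]
    rw [Finset.sum_comm]
    exact Finset.sum_eq_zero hcsum

lemma crossZ_sum {ι : Type*} (u : Z2) (s : Finset ι) (f : ι → Z2) :
    crossZ u (∑ k ∈ s, f k) = ∑ k ∈ s, crossZ u (f k) := by
  simp only [crossZ, Prod.fst_sum, Prod.snd_sum, Finset.mul_sum, Finset.sum_sub_distrib]

/-- Nonzero vectors with sum zero, listed in the order of their angles, are the edges of a convex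
polygon. -/
lemma exists_intPolygon (m : ℕ) (E : Fin (m + 3) → Z2) (r θ : Fin (m + 3) → ℝ)
    (hr : ∀ k, 0 < r k) (hθ : StrictMono θ) (hθ' : ∀ i j, θ j - θ i < 2 * Real.pi)
    (hE₁ : ∀ k, ((E k).1 : ℝ) = r k * Real.cos (θ k))
    (hE₂ : ∀ k, ((E k).2 : ℝ) = r k * Real.sin (θ k)) (hsum : ∑ k, E k = 0) :
    ∃ P : IntPolygon, P.n = m ∧ (∀ i, ∃ k, P.edgeVec i = E k) ∧
      ∀ k, ∃ i, P.edgeVec i = E k := by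
  have hpos : 0 < m + 3 := by omega
  let idx : ℕ → Fin (m + 3) := fun k => ⟨k % (m + 3), Nat.mod_lt _ hpos⟩
  have hidx : ∀ i : Fin (m + 3), idx i = i := fun i => Fin.ext (Nat.mod_eq_of_lt i.2)
  have hidx' : ∀ k, idx (k + (m + 3)) = idx k := fun k => Fin.ext (Nat.add_mod_right _ _)
  let Θ : ℕ → ℝ := fun k => θ (idx k) + (k / (m + 3) : ℕ) * (2 * Real.pi)
  have hΘ' : ∀ k, Θ (k + (m + 3)) = Θ k + 2 * Real.pi := by
    intro k
    simp only [Θ, hidx', Nat.add_div_right k hpos]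
    push_cast
    ring
  have hΘ : StrictMono Θ := by
    refine strictMono_nat_of_lt_succ fun k => ?_
    have hk := Nat.div_add_mod k (m + 3)
    have hlt := Nat.mod_lt k hpos
    have hk1 : k + 1 = (m + 3) * (k / (m + 3)) + (k % (m + 3) + 1) := by omega
    rcases Nat.lt_or_ge (k % (m + 3) + 1) (m + 3) with hcase | hcase
    · have hdiv : (k + 1) / (m + 3) = k / (m + 3) := by
        rw [hk1, Nat.mul_add_div hpos, Nat.div_eq_of_lt hcase, add_zero]
      have hmod : (k + 1) % (m + 3) = k % (m + 3) + 1 := by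
        rw [hk1, Nat.mul_add_mod, Nat.mod_eq_of_lt hcase]
      simp only [Θ, hdiv]
      have : θ (idx k) < θ (idx (k + 1)) := hθ (by simp only [idx, Fin.lt_def]; omega)
      linarith
    · have heq : k % (m + 3) + 1 = m + 3 := by omega
      have hdiv : (k + 1) / (m + 3) = k / (m + 3) + 1 := by
        rw [hk1, Nat.mul_add_div hpos, heq, Nat.div_self hpos]
      simp only [Θ, hdiv]
      have := hθ' (idx (k + 1)) (idx k)
      push_cast
      linarith
  let V : ℕ → Z2 := fun j => ∑ k ∈ Finset.range j, E (idx k)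
  have hVsub : ∀ i j, i ≤ j → V j - V i = ∑ k ∈ Finset.Ico i j, E (idx k) := fun i j hij =>
    (Finset.sum_Ico_eq_sub _ hij).symm
  have hVn : ∀ j, V (j + (m + 3)) = V j := by
    intro j
    induction j with
    | zero =>
      simp only [V, zero_add, Finset.range_zero, Finset.sum_empty]
      rw [← hsum, Finset.sum_range]
      simp only [hidx]
    | succ j ih =>
      have e1 : V (j + 1 + (m + 3)) = V (j + (m + 3)) + E (idx (j + (m + 3))) := by
        rw [add_right_comm]
        exact Finset.sum_range_succ _ _
      have e2 : V (j + 1) = V j + E (idx j) := Finset.sum_range_succ _ _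
      rw [e1, e2, ih, hidx']
  have hVsucc : ∀ i : Fin (m + 3), V (i + 1 : Fin (m + 3)) - V i = E i := by
    intro i
    have hval : ((i + 1 : Fin (m + 3)) : ℕ) = (i + 1) % (m + 3) := by simp [Fin.val_add]
    have : V (i + 1 : Fin (m + 3)) = V (i + 1 : ℕ) := by
      rw [hval]
      rcases Nat.lt_or_ge ((i : ℕ) + 1) (m + 3) with h | h
      · rw [Nat.mod_eq_of_lt h]
      · have h' : (i : ℕ) + 1 = 0 + (m + 3) := by have := i.2; omega
        rw [h', hVn, zero_add, Nat.mod_self]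
    rw [this, hVsub _ _ (Nat.le_succ _)]
    simp [hidx]
  have hcross : ∀ (i : Fin (m + 3)) (k : ℕ),
      (crossZ (E i) (E (idx k)) : ℝ) = r i * r (idx k) * Real.sin (Θ k - Θ i) := by
    intro i k
    have e1 : Real.cos (Θ k) = Real.cos (θ (idx k)) := Real.cos_add_nat_mul_two_pi _ _
    have e2 : Real.sin (Θ k) = Real.sin (θ (idx k)) := Real.sin_add_nat_mul_two_pi _ _
    have e3 : Θ i = θ i := by simp [Θ, hidx, Nat.div_eq_of_lt i.2]
    rw [Real.sin_sub, e1, e2, e3]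
    simp only [crossZ]
    push_cast
    rw [hE₁, hE₁, hE₂, hE₂]
    ring
  have hconvex : ∀ (i : Fin (m + 3)) (j : ℕ), (i : ℕ) + 2 ≤ j → j < i + (m + 3) →
      0 < crossZ (E i) (V j - V i) := by
    intro i j hij hji
    have hself : crossZ (E i) (E (idx i)) = 0 := by rw [hidx]; simp only [crossZ]; ring
    rw [hVsub _ _ (by omega), crossZ_sum]
    rcases le_or_gt (Θ j - Θ i) Real.pi with hle | hgt
    · rw [Finset.sum_eq_sum_Ico_succ_bot (by omega), hself, zero_add]
      refine Finset.sum_pos (fun k hk => ?_) ⟨i + 1, by simp; omega⟩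
      rw [Finset.mem_Ico] at hk
      have h1 : Θ i < Θ k := hΘ (by omega)
      have h2 : Θ k < Θ j := hΘ hk.2
      have := mul_pos (mul_pos (hr i) (hr (idx k)))
        (Real.sin_pos_of_pos_of_lt_pi (x := Θ k - Θ i) (by linarith) (by linarith))
      rw [← hcross] at this
      exact_mod_cast this
    · have htot : ∑ k ∈ Finset.Ico (i : ℕ) j, crossZ (E i) (E (idx k)) +
          ∑ k ∈ Finset.Ico j (i + (m + 3)), crossZ (E i) (E (idx k)) = 0 := by
        rw [Finset.sum_Ico_consecutive _ (by omega) hji.le, ← crossZ_sum, ← hVsub _ _ (by omega),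
          hVn, sub_self]
        simp [crossZ]
      have hneg : ∑ k ∈ Finset.Ico j (i + (m + 3)), crossZ (E i) (E (idx k)) < 0 := by
        refine Finset.sum_neg (fun k hk => ?_) ⟨j, by simpa using hji⟩
        rw [Finset.mem_Ico] at hk
        have h1 : Θ j ≤ Θ k := hΘ.monotone hk.1
        have h2 : Θ k < Θ i + 2 * Real.pi := hΘ' i ▸ hΘ hk.2
        have hsin := Real.sin_neg_of_neg_of_neg_pi_lt (x := Θ k - Θ i - 2 * Real.pi)
          (by linarith) (by linarith)
        rw [Real.sin_sub_two_pi] at hsin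
        have := mul_neg_of_pos_of_neg (mul_pos (hr i) (hr (idx k))) hsin
        rw [← hcross] at this
        exact_mod_cast this
      linarith
  refine ⟨⟨m, fun i => V i, fun i j hji hji1 => ?_⟩, rfl, fun i => ⟨i, hVsucc i⟩,
    fun k => ⟨k, hVsucc k⟩⟩
  rw [hVsucc]
  have hi := i.2
  have hj := j.2
  have hne : (j : ℕ) ≠ i := fun h => hji (Fin.ext h)
  have hne1 : (j : ℕ) ≠ (i + 1) % (m + 3) := fun h =>
    hji1 (Fin.ext (by simpa [Fin.val_add] using h))
  rcases Nat.lt_or_ge i j with hlt | hge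
  · rw [Nat.mod_eq_of_lt (by omega)] at hne1
    exact hconvex i j (by omega) (by omega)
  · rw [← hVn j]
    refine hconvex i _ ?_ (by omega)
    by_contra hcon
    rw [show (i : ℕ) + 1 = m + 3 by omega, Nat.mod_self] at hne1
    omega

/-- Primitive vectors which positively span the plane are the directions of the edges of a convex
polygon. -/
lemma exists_intPolygon_of_crossZ_pos (hcard : 3 ≤ D.card)
    (hprim : ∀ v ∈ D, Int.gcd v.1 v.2 = 1)
    (h : ∀ w : Z2, w ≠ 0 → ∃ v ∈ D, 0 < crossZ w v) :
    ∃ P : IntPolygon, P.n + 3 = D.card ∧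
      (∀ i : Fin (P.n + 3), ∃ v ∈ D, SameRay ℝ (toR2 (P.edgeVec i)) (toR2 v)) ∧
      (∀ v ∈ D, ∃ i : Fin (P.n + 3), SameRay ℝ (toR2 (P.edgeVec i)) (toR2 v)) := by
  obtain ⟨m, hm⟩ : ∃ m, D.card = m + 3 := ⟨D.card - 3, by omega⟩
  have hne : ∀ v ∈ D, v ≠ 0 := fun v hv => ne_zero_of_gcd (hprim v hv)
  obtain ⟨c, hc, hsum⟩ := exists_pos_combination hne h
  let z : Z2 → ℂ := fun v => ⟨v.1, v.2⟩
  have hz : ∀ v ∈ D, z v ≠ 0 := by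
    intro v hv h0
    have h1 := congrArg Complex.re h0
    have h2 := congrArg Complex.im h0
    simp only [z, Complex.zero_re, Complex.zero_im, Int.cast_eq_zero] at h1 h2
    exact hne v hv (Prod.ext h1 h2)
  have hinj : Set.InjOn (fun v => (z v).arg) D := by
    intro u hu v hv huv
    refine eq_of_sameRay (hprim u hu) (hprim v hv) ?_
    have := (Complex.sameRay_of_arg_eq huv).map
      ((Complex.reLm).prod Complex.imLm)
    simpa [z, toR2] using this
  have hcard' : (D.image fun v => (z v).arg).card = m + 3 := by
    rw [Finset.card_image_of_injOn hinj, hm]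
  let θ := (D.image fun v => (z v).arg).orderEmbOfFin hcard'
  have hmem : ∀ k, ∃ v ∈ D, (z v).arg = θ k := fun k =>
    Finset.mem_image.1 (Finset.orderEmbOfFin_mem _ hcard' k)
  choose e he hθ using hmem
  have hsurj : ∀ v ∈ D, ∃ k, e k = v := by
    intro v hv
    have : (z v).arg ∈ Set.range θ := by
      rw [Finset.range_orderEmbOfFin]
      exact Finset.mem_coe.2 (Finset.mem_image.2 ⟨v, hv, rfl⟩)
    obtain ⟨k, hk⟩ := this
    exact ⟨k, hinj (he k) hv ((hθ k).trans hk)⟩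
  have heinj : Function.Injective e := by
    intro i j hij
    refine θ.injective ?_
    rw [← hθ i, ← hθ j, hij]
  have hsum' : ∑ k, c (e k) • e k = 0 := by
    rw [← hsum, ← Finset.sum_image (f := fun v => c v • v) (s := Finset.univ) heinj.injOn]
    congr 1
    ext v
    simp only [Finset.mem_image, Finset.mem_univ, true_and]
    exact ⟨fun ⟨k, hk⟩ => hk ▸ he k, hsurj v⟩
  obtain ⟨P, hPn, hP₁, hP₂⟩ := exists_intPolygon m (fun k => c (e k) • e k)
    (fun k => c (e k) * ‖z (e k)‖) θ
    (fun k => mul_pos (by exact_mod_cast hc _ (he k)) (norm_pos_iff.2 (hz _ (he k))))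
    θ.strictMono
    (fun i j => by
      rw [← hθ i, ← hθ j]
      have := Complex.neg_pi_lt_arg (z (e i))
      have := Complex.arg_le_pi (z (e j))
      linarith)
    (fun k => by rw [← hθ, mul_assoc, Complex.norm_mul_cos_arg]; simp [z])
    (fun k => by rw [← hθ, mul_assoc, Complex.norm_mul_sin_arg]; simp [z]) hsum'
  have hray : ∀ k, SameRay ℝ (toR2 (c (e k) • e k)) (toR2 (e k)) := fun k => by
    rw [toR2_smul]
    exact SameRay.sameRay_nonneg_smul_left _ (by exact_mod_cast (hc _ (he k)).le)
  refine ⟨P, by rw [hPn, hm], fun i => ?_, fun v hv => ?_⟩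
  · obtain ⟨k, hk⟩ := hP₁ i
    exact ⟨e k, he k, hk ▸ hray k⟩
  · obtain ⟨k, rfl⟩ := hsurj v hv
    obtain ⟨i, hi⟩ := hP₂ k
    exact ⟨i, hi ▸ hray k⟩

end Polygons

/-- for an infinite subshift `X` whose nonexpansive rays form a finite
set `D` of rational closing rays: (1) for any rational one-dimensional subspace `E`
(directed by `w ≠ 0`) both of whose rays are expansive, there are nonexpansive
directions on both sides of `E`, so `X` has at least two nonexpansive rays;
(2) if there are exactly two nonexpansive rays, they are antiparallel;
(3) if there are `n ≥ 3` nonexpansive rays, there are nonzero integer vectors, one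
in each nonexpansive ray, forming (in cyclic order) the oriented edges of a convex
polygon. -/
theorem statement15 {A : Type} [Fintype A] [Nonempty A] (X : Set (Config A))
    (hX : IsSubshift X) (hInf : X.Infinite)
    (D : Finset Z2) (hD : NonexpansiveDirSet X D) (hcl : ∀ v ∈ D, ClosingRay X v) :
    (∀ w : Z2, w ≠ 0 → ExpansiveRay X (toR2 w) → ExpansiveRay X (-toR2 w) →
      (∃ v₁ ∈ D, ∃ v₂ ∈ D, 0 < crossZ w v₁ ∧ crossZ w v₂ < 0) ∧ 2 ≤ D.card) ∧
    (D.card = 2 → ∀ v ∈ D, -v ∈ D) ∧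
    (3 ≤ D.card → ∃ P : IntPolygon, P.n + 3 = D.card ∧
      (∀ i : Fin (P.n + 3), ∃ v ∈ D, SameRay ℝ (toR2 (P.edgeVec i)) (toR2 v)) ∧
      (∀ v ∈ D, ∃ i : Fin (P.n + 3), SameRay ℝ (toR2 (P.edgeVec i)) (toR2 v))) := by
  refine ⟨fun w hw h1 h2 => ?_, fun hcard v hv => ?_, fun hcard => ?_⟩
  · obtain ⟨v₁, hv₁, hpos⟩ := hD.exists_crossZ_pos_of_expansive hX hInf hcl hw h1 h2
    obtain ⟨v₂, hv₂, hneg⟩ := hD.exists_crossZ_pos_of_expansive hX hInf hcl (neg_ne_zero.2 hw)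
      (by rwa [toR2_neg]) (by rwa [toR2_neg, neg_neg])
    rw [← neg_one_smul ℤ w, crossZ_smul_left] at hneg
    refine ⟨⟨v₁, hv₁, v₂, hv₂, hpos, by linarith⟩, ?_⟩
    refine Finset.one_lt_card.2 ⟨v₁, hv₁, v₂, hv₂, ?_⟩
    rintro rfl
    linarith
  · obtain ⟨a, b, hab, rfl⟩ := Finset.card_eq_two.1 hcard
    have hb := hD.neg_eq_of_eq_pair hX hcl hab rfl
    simp only [Finset.mem_insert, Finset.mem_singleton] at hv ⊢
    rcases hv with rfl | rfl
    · exact Or.inr hb.symm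
    · exact Or.inl (by rw [hb, neg_neg])
  · exact exists_intPolygon_of_crossZ_pos hcard hD.1 fun w hw =>
      hD.exists_crossZ_pos hX hcl hcard hw

end PolygonalShifts
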